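/- arXiv:math/0511173 — 7 statements merged into one kernel-verified Lean document; each statement's English description precedes it below -/
import Mathlib

section
/- Let m, λ₁, λ₂ be positive integers, set n₁ = mλ₁ and n₂ = mλ₂ (both over the same alphabet of m symbols), and let d₁, d₂ ≥ 1. Then M_{λ₁+λ₂}(n₁+n₂, d₁+d₂) ≥ min{ M_{λ₁}(n₁,d₁), M_{λ₂}(n₂,d₂) }. In particular, M_{2λ}(2n,2d) ≥ M_λ(n,d) for n = mλ. -/
/-- A frequency permutation array: a finite set `T` of words `ι → α` such that every word
uses each symbol of `α` exactly `lam` times, and distinct words have Hamming distance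
at least `d`. -/
def isFPA {ι α : Type*} [Fintype ι] [DecidableEq ι] [DecidableEq α]
    (lam d : ℕ) (T : Finset (ι → α)) : Prop :=
  (∀ w ∈ T, ∀ s : α, (Finset.univ.filter (fun i => w i = s)).card = lam) ∧
  (∀ w ∈ T, ∀ v ∈ T, w ≠ v → d ≤ hammingDist w v)

/-- `M n m lam d` is the maximum size of a frequency permutation array of words of
length `n` over `m` symbols, each symbol occurring `lam` times, with minimum
Hamming distance `d`. -/
noncomputable def M (n m lam d : ℕ) : ℕ :=
  sSup {N | ∃ T : Finset (Fin n → Fin m), isFPA lam d T ∧ T.card = N}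

theorem M_bdd (n m lam d : ℕ) :
    BddAbove {N | ∃ T : Finset (Fin n → Fin m), isFPA lam d T ∧ T.card = N} := by
  refine ⟨Fintype.card (Fin n → Fin m), ?_⟩
  rintro N ⟨T, -, rfl⟩
  exact Finset.card_le_univ T

theorem M_attained (n m lam d : ℕ) :
    ∃ T : Finset (Fin n → Fin m), isFPA lam d T ∧ T.card = M n m lam d :=
  Nat.sSup_mem (s := {N | ∃ T : Finset (Fin n → Fin m), isFPA lam d T ∧ T.card = N})
    ⟨0, ∅, by simp [isFPA], rfl⟩ (M_bdd n m lam d)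

theorem card_filter_append {a b : ℕ} (p : Fin (a + b) → Prop) [DecidablePred p] :
    (Finset.univ.filter p).card =
      (Finset.univ.filter (fun i => p (Fin.castAdd b i))).card +
      (Finset.univ.filter (fun i => p (Fin.natAdd a i))).card := by
  simp only [Finset.card_filter, Fin.sum_univ_add]

theorem M_add (n₁ n₂ m lam₁ lam₂ d₁ d₂ : ℕ) :
    min (M n₁ m lam₁ d₁) (M n₂ m lam₂ d₂) ≤ M (n₁ + n₂) m (lam₁ + lam₂) (d₁ + d₂) := by
  obtain ⟨T₁, ⟨hf₁, hh₁⟩, hc₁⟩ := M_attained n₁ m lam₁ d₁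
  obtain ⟨T₂, ⟨hf₂, hh₂⟩, hc₂⟩ := M_attained n₂ m lam₂ d₂
  obtain ⟨S₁, hS₁, hk₁⟩ := Finset.exists_subset_card_eq
    (hc₁ ▸ min_le_left _ _ : min (M n₁ m lam₁ d₁) (M n₂ m lam₂ d₂) ≤ T₁.card)
  obtain ⟨S₂, hS₂, hk₂⟩ := Finset.exists_subset_card_eq
    (hc₂ ▸ min_le_right _ _ : min (M n₁ m lam₁ d₁) (M n₂ m lam₂ d₂) ≤ T₂.card)
  let e : S₁ ≃ S₂ := Finset.equivOfCardEq (hk₁.trans hk₂.symm)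
  let f : S₁ → (Fin (n₁ + n₂) → Fin m) := fun x => Fin.append x.1 (e x).1
  have hf : Function.Injective f := by
    intro x y h
    apply Subtype.ext
    funext i
    have := congrFun h (Fin.castAdd n₂ i)
    simpa [f] using this
  refine le_csSup (M_bdd _ _ _ _) ⟨Finset.univ.image f, ⟨?_, ?_⟩, ?_⟩
  · intro w hw s
    obtain ⟨x, -, rfl⟩ := Finset.mem_image.1 hw
    rw [card_filter_append]
    simp only [f, Fin.append_left, Fin.append_right]
    rw [hf₁ _ (hS₁ x.2), hf₂ _ (hS₂ (e x).2)]
  · intro w hw v hv hne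
    obtain ⟨x, -, rfl⟩ := Finset.mem_image.1 hw
    obtain ⟨y, -, rfl⟩ := Finset.mem_image.1 hv
    have hxy : x ≠ y := fun h => hne (h ▸ rfl)
    have h1 := hh₁ _ (hS₁ x.2) _ (hS₁ y.2) (fun h => hxy (Subtype.ext h))
    have h2 := hh₂ _ (hS₂ (e x).2) _ (hS₂ (e y).2)
      (fun h => hxy (e.injective (Subtype.ext h)))
    unfold hammingDist at h1 h2 ⊢
    rw [card_filter_append]
    simp only [f, Fin.append_left, Fin.append_right]
    exact add_le_add h1 h2
  · rw [Finset.card_image_of_injective _ hf]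
    simpa using hk₁

/-- For `n₁ = m·λ₁`, `n₂ = m·λ₂`, `d₁,d₂ ≥ 1`:
`M_{λ₁+λ₂}(n₁+n₂, d₁+d₂) ≥ min (M_{λ₁}(n₁,d₁)) (M_{λ₂}(n₂,d₂))`; in particular
`M_{2λ}(2n,2d) ≥ M_λ(n,d)` for `n = m·λ`. -/
theorem stmt_3 (m lam₁ lam₂ d₁ d₂ : ℕ) (hm : 0 < m) (hl₁ : 0 < lam₁) (hl₂ : 0 < lam₂)
    (hd₁ : 1 ≤ d₁) (hd₂ : 1 ≤ d₂) :
    min (M (m * lam₁) m lam₁ d₁) (M (m * lam₂) m lam₂ d₂) ≤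
      M (m * lam₁ + m * lam₂) m (lam₁ + lam₂) (d₁ + d₂) ∧
    ∀ lam d : ℕ, 0 < lam → 1 ≤ d →
      M (m * lam) m lam d ≤ M (2 * (m * lam)) m (2 * lam) (2 * d) := by
  refine ⟨M_add _ _ _ _ _ _ _, fun lam d _ _ => ?_⟩
  have h := M_add (m * lam) (m * lam) m lam lam d d
  rw [min_self] at h
  rwa [two_mul, two_mul, two_mul]
end

section
/- If there exist m mutually orthogonal latin squares of order n, then there exists a frequency permutation array FPA_n(n², n² − n) of size m + 2; concretely, writing the n rows of each of the m + 2 latin squares in an associated complete set side-by-side to form words of length n² yields m + 2 words, each containing every one of the n symbols exactly n times, with pairwise Hamming distance at least n² − n. In particular, if q is a prime power, there exists an FPA_q(q², q² − q) of size q + 1. -/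
/-- Core counting lemma: pairwise orthogonal words form a frequency permutation array. -/
theorem fpa_core {κ : Type*} [Fintype κ] (n : ℕ) (hn : 2 ≤ n) (hκ : 2 ≤ Fintype.card κ)
    (W : κ → Fin (n * n) → Fin n)
    (hW : ∀ e e', e ≠ e' → Function.Injective (fun p => (W e p, W e' p))) :
    ∃ T : Finset (Fin (n * n) → Fin n), isFPA n (n * n - n) T ∧ T.card = Fintype.card κ := by
  classical
  have hbij : ∀ e e', e ≠ e' → Function.Bijective (fun p => (W e p, W e' p)) := by
    intro e e' h
    rw [Fintype.bijective_iff_injective_and_card]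
    exact ⟨hW e e' h, by simp⟩
  have hcount : ∀ e e', e ≠ e' →
      (Finset.univ.filter (fun p => W e p = W e' p)).card = n := by
    intro e e' h
    have : (Finset.univ.filter (fun p => W e p = W e' p)).card
        = (Finset.univ : Finset (Fin n)).card := by
      apply Finset.card_bij (fun p _ => W e p)
      · simp
      · intro a ha b hb hab
        simp only [Finset.mem_filter, Finset.mem_univ, true_and] at ha hb
        apply hW e e' h
        simp only [Prod.mk.injEq]
        exact ⟨hab, by rw [← ha, ← hb, hab]⟩
      · intro s _
        obtain ⟨p, hp⟩ := (hbij e e' h).2 (s, s)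
        simp only [Prod.mk.injEq] at hp
        exact ⟨p, by simp [hp.1, hp.2], hp.1⟩
    simpa using this
  have hdist : ∀ e e', e ≠ e' → n * n - n ≤ hammingDist (W e) (W e') := by
    intro e e' h
    have h1 := Finset.card_filter_add_card_filter_not
      (s := (Finset.univ : Finset (Fin (n * n)))) (fun p => W e p = W e' p)
    rw [hcount e e' h] at h1
    simp only [Finset.card_univ, Fintype.card_fin] at h1
    unfold hammingDist
    simp only [ne_eq]
    omega
  have hinj : Function.Injective W := by
    intro e e' hee
    by_contra h
    have h1 := hdist e e' h
    rw [hee, hammingDist_self] at h1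
    have : 2 * n ≤ n * n := Nat.mul_le_mul_right n hn
    omega
  refine ⟨Finset.univ.image W, ⟨?_, ?_⟩, ?_⟩
  · intro w hw s
    simp only [Finset.mem_image, Finset.mem_univ, true_and] at hw
    obtain ⟨e, rfl⟩ := hw
    have : Nontrivial κ := Fintype.one_lt_card_iff_nontrivial.mp hκ
    obtain ⟨e', he'⟩ := exists_ne e
    have : (Finset.univ.filter (fun p => W e p = s)).card
        = (Finset.univ : Finset (Fin n)).card := by
      apply Finset.card_bij (fun p _ => W e' p)
      · simp
      · intro a ha b hb hab
        simp only [Finset.mem_filter, Finset.mem_univ, true_and] at ha hb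
        apply hW e e' he'.symm
        simp only [Prod.mk.injEq]
        exact ⟨by rw [ha, hb], hab⟩
      · intro t _
        obtain ⟨p, hp⟩ := (hbij e e' he'.symm).2 (s, t)
        simp only [Prod.mk.injEq] at hp
        exact ⟨p, by simp [hp.1], hp.2⟩
    simpa using this
  · intro w hw v hv hwv
    simp only [Finset.mem_image, Finset.mem_univ, true_and] at hw hv
    obtain ⟨e, rfl⟩ := hw
    obtain ⟨e', rfl⟩ := hv
    exact hdist e e' (fun h => hwv (by rw [h]))
  · rw [Finset.card_image_of_injective _ hinj, Finset.card_univ]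

/-- The core lemma for squares indexed by an arbitrary symbol set. -/
theorem fpa_general {κ α : Type*} [Fintype κ] [Fintype α] (n : ℕ) (hα : Fintype.card α = n)
    (hn : 2 ≤ n) (hκ : 2 ≤ Fintype.card κ) (W : κ → α × α → α)
    (hW : ∀ e e', e ≠ e' → Function.Injective (fun p => (W e p, W e' p))) :
    ∃ T : Finset (Fin (n * n) → Fin n), isFPA n (n * n - n) T ∧ T.card = Fintype.card κ := by
  have φ : α ≃ Fin n := Fintype.equivFinOfCardEq hα
  have ψ : α × α ≃ Fin (n * n) :=
    Fintype.equivFinOfCardEq (by rw [Fintype.card_prod, hα])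
  apply fpa_core n hn hκ (fun e p => φ (W e (ψ.symm p)))
  intro e e' h a b hab
  simp only [Prod.mk.injEq, EmbeddingLike.apply_eq_iff_eq] at hab
  apply ψ.symm.injective
  apply hW e e' h
  simp only [Prod.mk.injEq]
  exact hab

/-- If there exist `m` mutually orthogonal latin squares of order `n ≥ 2`, then
there exists an `FPA_n(n², n² − n)` of size `m + 2`. In particular, for a prime
power `q` there exists an `FPA_q(q², q² − q)` of size `q + 1`. -/
theorem stmt_13 (n m : ℕ) (hn : 2 ≤ n)
    (L : Fin m → (Fin n → Fin n → Fin n))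
    (hrow : ∀ e, ∀ i s : Fin n, (Finset.univ.filter (fun j => L e i j = s)).card = 1)
    (hcol : ∀ e, ∀ j s : Fin n, (Finset.univ.filter (fun i => L e i j = s)).card = 1)
    (horth : ∀ e e', e ≠ e' → ∀ a b : Fin n,
      (Finset.univ.filter
        (fun p : Fin n × Fin n => L e p.1 p.2 = a ∧ L e' p.1 p.2 = b)).card = 1) :
    (∃ T : Finset (Fin (n * n) → Fin n), isFPA n (n * n - n) T ∧ T.card = m + 2) ∧
    ∀ q : ℕ, IsPrimePow q →
      ∃ T : Finset (Fin (q * q) → Fin q), isFPA q (q * q - q) T ∧ T.card = q + 1 := by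
  refine ⟨?_, ?_⟩
  · have hr : ∀ e i j j', L e i j = L e i j' → j = j' := by
      intro e i j j' h
      exact Finset.card_le_one.mp (hrow e i (L e i j')).le j (by simp [h]) j' (by simp)
    have hc : ∀ e i i' j, L e i j = L e i' j → i = i' := by
      intro e i i' j h
      exact Finset.card_le_one.mp (hcol e j (L e i' j)).le i (by simp [h]) i' (by simp)
    have ho : ∀ e e', e ≠ e' → ∀ p p' : Fin n × Fin n, L e p.1 p.2 = L e p'.1 p'.2 →
        L e' p.1 p.2 = L e' p'.1 p'.2 → p = p' := by
      intro e e' hne p p' h h'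
      exact Finset.card_le_one.mp (horth e e' hne (L e p'.1 p'.2) (L e' p'.1 p'.2)).le
        p (by simp [h, h']) p' (by simp)
    have key := fpa_general (κ := Option (Option (Fin m))) (α := Fin n) n (by simp) hn (by simp)
      (fun e p => match e with
        | none => p.1
        | some none => p.2
        | some (some e) => L e p.1 p.2) ?_
    · simpa using key
    · rintro (_ | _ | e) (_ | _ | e') hne ⟨a, b⟩ ⟨a', b'⟩ h <;>
        simp only [Prod.mk.injEq] at h <;> obtain ⟨h1, h2⟩ := h
      · exact absurd rfl hne
      · rw [h1, h2]
      · subst h1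
        rw [hr e' _ _ _ h2]
      · rw [h1, h2]
      · exact absurd rfl hne
      · subst h1
        rw [hc e' _ _ _ h2]
      · subst h2
        rw [hr e _ _ _ h1]
      · subst h2
        rw [hc e _ _ _ h1]
      · exact ho e e' (fun h => hne (by rw [h])) _ _ h1 h2
  · intro q hq
    have hq2 : 2 ≤ q := hq.two_le
    obtain ⟨p, k, hp, hk, rfl⟩ := hq
    haveI : Fact p.Prime := ⟨hp.nat_prime⟩
    haveI : Fintype (GaloisField p k) := Fintype.ofFinite _
    have hcard : Fintype.card (GaloisField p k) = p ^ k := by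
      rw [← Nat.card_eq_fintype_card, GaloisField.card p k hk.ne']
    have key := fpa_general (κ := Option (GaloisField p k)) (α := GaloisField p k) (p ^ k)
      hcard hq2 (by rw [Fintype.card_option, hcard]; omega)
      (fun e x => match e with
        | none => x.1
        | some c => c * x.1 + x.2) ?_
    · rw [Fintype.card_option, hcard] at key
      exact key
    · rintro (_ | c) (_ | c') hne ⟨a, b⟩ ⟨a', b'⟩ h <;>
        simp only [Prod.mk.injEq] at h <;> obtain ⟨h1, h2⟩ := h
      · exact absurd rfl hne
      · subst h1
        rw [add_left_cancel h2]
      · subst h2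
        rw [add_left_cancel h1]
      · have hcc : c - c' ≠ 0 := fun h => hne (by rw [sub_eq_zero.mp h])
        have ha : a = a' := mul_left_cancel₀ hcc (by linear_combination h1 - h2)
        subst ha
        rw [add_left_cancel h1]
end

section
/- Let v, r, s be positive integers with s ≥ 2 and s² dividing v. Every orthogonal array OA[v,r,s,2] of strength 2 is an equidistant frequency permutation array FPA_{v/s}(v, v − v/s) of size r: each of its r rows contains each of the s symbols exactly v/s times, and any two distinct rows agree in exactly v/s positions, hence have Hamming distance exactly v − v/s. -/
/-- Every orthogonal array `OA[v,r,s,2]` of strength `2` is an equidistant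
`FPA_{v/s}(v, v − v/s)` of size `r`: each row contains each symbol exactly `v/s`
times, any two distinct rows have Hamming distance exactly `v − v/s`, the rows are
pairwise distinct, and they form an `FPA_{v/s}(v, v − v/s)` of size `r`. -/
theorem stmt_14 (v r s : ℕ) (hv : 0 < v) (hr : 2 ≤ r) (hs : 2 ≤ s) (hdvd : s * s ∣ v)
    (A : Fin r → Fin v → Fin s)
    (hOA : ∀ k k' : Fin r, k ≠ k' → ∀ a b : Fin s,
      (Finset.univ.filter (fun j => A k j = a ∧ A k' j = b)).card = v / (s * s)) :
    (∀ k : Fin r, ∀ a : Fin s, (Finset.univ.filter (fun j => A k j = a)).card = v / s) ∧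
    (∀ k k' : Fin r, k ≠ k' → hammingDist (A k) (A k') = v - v / s) ∧
    Function.Injective A ∧
    isFPA (v / s) (v - v / s) (Finset.univ.image A) ∧
    (Finset.univ.image A).card = r := by
  obtain ⟨q, rfl⟩ := hdvd
  have hss : 0 < s * s := by positivity
  have hs0 : 0 < s := by omega
  have hq : 0 < q := Nat.pos_of_mul_pos_left hv
  have e1 : s * s * q / (s * s) = q := Nat.mul_div_cancel_left q hss
  have e2 : s * s * q / s = s * q := by
    rw [mul_assoc]; exact Nat.mul_div_cancel_left _ hs0
  rw [e1] at hOA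
  rw [e2]
  have h1 : ∀ k : Fin r, ∀ a : Fin s,
      (Finset.univ.filter (fun j => A k j = a)).card = s * q := by
    intro k a
    have : Nontrivial (Fin r) := Fin.nontrivial_iff_two_le.mpr hr
    obtain ⟨k', hk'⟩ := exists_ne k
    rw [Finset.card_eq_sum_card_fiberwise (f := A k') (t := Finset.univ)
      (fun _ _ => Finset.mem_coe.mpr (Finset.mem_univ _))]
    simp only [Finset.filter_filter]
    rw [Finset.sum_congr rfl (fun b _ => hOA k k' hk'.symm a b)]
    simp
  have h2 : ∀ k k' : Fin r, k ≠ k' → hammingDist (A k) (A k') = s * s * q - s * q := by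
    intro k k' hk
    have hagree : (Finset.univ.filter (fun j => A k j = A k' j)).card = s * q := by
      rw [Finset.card_eq_sum_card_fiberwise (f := A k) (t := Finset.univ)
        (fun _ _ => Finset.mem_coe.mpr (Finset.mem_univ _))]
      simp only [Finset.filter_filter]
      have : ∀ b ∈ (Finset.univ : Finset (Fin s)),
          (Finset.univ.filter (fun j => A k j = A k' j ∧ A k j = b)).card = q := by
        intro b _
        refine Eq.trans ?_ (hOA k k' hk b b)
        congr 1
        ext j
        simp only [Finset.mem_filter, Finset.mem_univ, true_and]
        constructor
        · rintro ⟨h, h'⟩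
          exact ⟨h', h ▸ h'⟩
        · rintro ⟨h, h'⟩
          exact ⟨h.trans h'.symm, h⟩
      rw [Finset.sum_congr rfl this]
      simp
    have hsum := Finset.card_filter_add_card_filter_not
      (s := (Finset.univ : Finset (Fin (s * s * q)))) (fun j => A k j = A k' j)
    rw [hagree, Finset.card_univ, Fintype.card_fin] at hsum
    have hd : hammingDist (A k) (A k') =
        (Finset.univ.filter (fun j => ¬ A k j = A k' j)).card := rfl
    omega
  have hinj : Function.Injective A := by
    intro k k' h
    by_contra hk
    have := h2 k k' hk
    rw [h, hammingDist_self] at this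
    have : s * q < s * s * q := by
      have h3 : 0 < s * q := by positivity
      rw [mul_assoc]
      nlinarith
    omega
  refine ⟨h1, h2, hinj, ⟨?_, ?_⟩, ?_⟩
  · intro w hw
    obtain ⟨k, _, rfl⟩ := Finset.mem_image.mp hw
    exact h1 k
  · intro w hw w' hw' hne
    obtain ⟨k, _, rfl⟩ := Finset.mem_image.mp hw
    obtain ⟨k', _, rfl⟩ := Finset.mem_image.mp hw'
    exact (h2 k k' (fun h => hne (h ▸ rfl))).ge
  · rw [Finset.card_image_of_injective _ hinj]
    simp
end

section
/- Let q be a prime power and let C ⊆ F_q^n be a linear [n,k,d] MDS code, i.e. a k-dimensional subspace of minimum Hamming weight d = n − k + 1, with k ≥ 2. For each coordinate i ∈ {1,…,n}, let row_i : C → F_q be the evaluation map c ↦ c_i. Then: (a) for each i, every element of F_q is attained by row_i on exactly q^{k−1} codewords of C; (b) for any two distinct coordinates i ≠ j, the maps row_i and row_j agree on exactly q^{k−1} codewords, i.e. differ on exactly q^k − q^{k−1} codewords. Hence the n × q^k array whose columns are the codewords of C is a frequency permutation array FPA_{q^{k−1}}(q^k, q^{k−1}(q−1)) of size n. -/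
theorem aux_interp {F : Type*} [Field F] [Fintype F] [DecidableEq F]
    (n k : ℕ) (C : Submodule F (Fin n → F)) (hdim : Module.finrank F C = k)
    (hmin : ∀ c ∈ C, c ≠ 0 → n - k + 1 ≤ hammingNorm c)
    (S : Finset (Fin n)) (hS : S.card = k) (f : Fin n → F) :
    ∃ c : C, ∀ s ∈ S, (c : Fin n → F) s = f s := by
  let r : C →ₗ[F] (S → F) :=
    { toFun := fun c s => (c : Fin n → F) s
      map_add' := fun _ _ => rfl
      map_smul' := fun _ _ => rfl }
  have hinj : Function.Injective r := by
    rw [← LinearMap.ker_eq_bot, LinearMap.ker_eq_bot']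
    intro c hc
    by_contra hne
    have h1 := hmin c c.2 (fun h => hne (Subtype.ext h))
    have h2 : hammingNorm (c : Fin n → F) ≤ Sᶜ.card := by
      unfold hammingNorm
      apply Finset.card_le_card
      intro s hs
      rw [Finset.mem_compl]
      intro hsS
      exact (Finset.mem_filter.mp hs).2 (congrFun hc ⟨s, hsS⟩)
    rw [Finset.card_compl, Fintype.card_fin, hS] at h2
    omega
  have hsurj : Function.Surjective r := by
    refine (LinearMap.injective_iff_surjective_of_finrank_eq_finrank ?_).mp hinj
    rw [hdim, Module.finrank_fintype_fun_eq_card, Fintype.card_coe, hS]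
  obtain ⟨c, hc⟩ := hsurj (fun s => f s)
  exact ⟨c, fun s hs => congrFun hc ⟨s, hs⟩⟩

theorem aux_fiber {F V : Type*} [Field F] [Fintype F] [AddCommGroup V] [Module F V]
    [Module.Finite F V] (k : ℕ) (hdim : Module.finrank F V = k)
    (φ : V →ₗ[F] F) (v : V) (hv : φ v = 1) (a : F) :
    Nat.card {c : V // φ c = a} = (Fintype.card F) ^ (k - 1) := by
  have hsurj : Function.Surjective φ := fun b => ⟨b • v, by simp [hv]⟩
  have hk := LinearMap.finrank_range_add_finrank_ker φ
  rw [LinearMap.range_eq_top.mpr hsurj, finrank_top, Module.finrank_self, hdim] at hk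
  have e : {c : V // φ c = a} ≃ LinearMap.ker φ :=
    { toFun := fun c => ⟨c.1 - a • v, by simp [hv, c.2]⟩
      invFun := fun c => ⟨c.1 + a • v, by
        have := c.2
        rw [LinearMap.mem_ker] at this
        simp [hv, this]⟩
      left_inv := fun c => by simp
      right_inv := fun c => by simp }
  rw [Nat.card_congr e, Module.natCard_eq_pow_finrank (K := F), Nat.card_eq_fintype_card]
  congr 1
  omega

/-- Construction from MDS codes.  Let `C ⊆ F^n` be a linear `[n,k,d]` MDS code over
the finite field `F` of order `q` (so every nonzero codeword has Hamming weight at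
least `n − k + 1`), with `k ≥ 2`.  Then `C` has exactly `q^k` codewords; for each
coordinate `i`, every element of `F` is attained as `i`-th coordinate by exactly
`q^{k−1}` codewords; and for distinct coordinates `i ≠ j`, exactly `q^{k−1}`
codewords agree in coordinates `i` and `j` (hence `q^k − q^{k−1}` disagree).  Thus
the array whose columns are the codewords is an `FPA_{q^{k−1}}(q^k, q^{k−1}(q−1))`
of size `n`. -/
theorem stmt_15 (F : Type*) [Field F] [Fintype F] [DecidableEq F]
    (n k : ℕ) (hk : 2 ≤ k)
    (C : Submodule F (Fin n → F)) (hdim : Module.finrank F C = k)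
    (hmin : ∀ c ∈ C, c ≠ 0 → n - k + 1 ≤ hammingNorm c) :
    Nat.card C = (Fintype.card F) ^ k ∧
    (∀ i : Fin n, ∀ a : F,
      Nat.card {c : C // (c : Fin n → F) i = a} = (Fintype.card F) ^ (k - 1)) ∧
    (∀ i j : Fin n, i ≠ j →
      Nat.card {c : C // (c : Fin n → F) i = (c : Fin n → F) j}
          = (Fintype.card F) ^ (k - 1) ∧
      Nat.card {c : C // (c : Fin n → F) i ≠ (c : Fin n → F) j}
          = (Fintype.card F) ^ k - (Fintype.card F) ^ (k - 1)) := by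
  have hkn : k ≤ n := by
    have := Submodule.finrank_le C
    rwa [hdim, Module.finrank_fintype_fun_eq_card, Fintype.card_fin] at this
  have hcard : Nat.card C = (Fintype.card F) ^ k := by
    rw [Module.natCard_eq_pow_finrank (K := F), Nat.card_eq_fintype_card, hdim]
  have key : ∀ T : Finset (Fin n), T.card ≤ 2 → ∀ f : Fin n → F,
      ∃ c : C, ∀ s ∈ T, (c : Fin n → F) s = f s := by
    intro T hT f
    obtain ⟨S, hTS, hS⟩ := Finset.exists_superset_card_eq (s := T) (n := k) (by omega)
      (by simpa using hkn)
    obtain ⟨c, hc⟩ := aux_interp n k C hdim hmin S hS f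
    exact ⟨c, fun s hs => hc s (hTS hs)⟩
  refine ⟨hcard, ?_, ?_⟩
  · intro i a
    obtain ⟨c, hc⟩ := key {i} (by simp) (fun _ => 1)
    exact aux_fiber k hdim ((LinearMap.proj i).comp C.subtype) c (hc i (by simp)) a
  · intro i j hij
    obtain ⟨c, hc⟩ := key {i, j} Finset.card_le_two (Pi.single i 1)
    have hi := hc i (by simp)
    have hj := hc j (by simp)
    have h1 : Nat.card {c : C // (c : Fin n → F) i = (c : Fin n → F) j}
          = (Fintype.card F) ^ (k - 1) := by
      rw [← aux_fiber k hdim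
        ((LinearMap.proj i).comp C.subtype - (LinearMap.proj j).comp C.subtype) c
        (by simp [hi, hj, hij.symm]) 0]
      exact Nat.card_congr (Equiv.subtypeEquivRight fun c => by simp [sub_eq_zero])
    refine ⟨h1, ?_⟩
    classical
    have h2 := Nat.card_congr
      (Equiv.sumCompl (fun c : C => (c : Fin n → F) i = (c : Fin n → F) j))
    rw [Nat.card_sum, h1, hcard] at h2
    have h3 : Nat.card {c : C // (c : Fin n → F) i ≠ (c : Fin n → F) j}
      = Nat.card {c : C // ¬ (c : Fin n → F) i = (c : Fin n → F) j} := rfl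
    omega
end

section
/- Let n = mλ with m, λ positive integers, and let A be a frequency permutation array FPA_λ(n,d) on the symbol set {0,1,…,m−1} with the additional property that for any two distinct rows of A, each of the m² ordered pairs (i,j) of symbols occurs in exactly t positions. Let r be a positive divisor of m with r ≥ 2. Then the array obtained from A by reducing every entry modulo r is a frequency permutation array FPA_{n/r}(n, n − tm²/r): each new row contains each of the r residues exactly n/r times, and any two rows coming from distinct rows of A have Hamming distance at least (in fact exactly) n − tm²/r. -/
theorem card_residue (m r : ℕ) (hr : 0 < r) (hdvd : r ∣ m) (c : ℕ) (hc : c < r) :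
    (Finset.univ.filter (fun a : Fin m => (a : ℕ) % r = c)).card = m / r := by
  obtain ⟨k, rfl⟩ := hdvd
  rw [Nat.mul_div_cancel_left _ hr]
  have h := Nat.count_modEq_card (r * k) hr c
  rw [Nat.mul_div_cancel_left _ hr, Nat.mul_mod_right] at h
  simp only [Nat.not_lt_zero, if_false, add_zero] at h
  rw [Nat.count_eq_card_filter_range] at h
  refine Eq.trans ?_ h
  refine Finset.card_bij (fun a _ => (a : ℕ)) ?_ ?_ ?_
  · intro a ha
    simp only [Finset.mem_filter, Finset.mem_univ, true_and] at ha
    simp [Nat.ModEq, ha, Nat.mod_eq_of_lt hc]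
  · intro a _ b _ hab
    exact Fin.ext hab
  · intro b hb
    simp only [Finset.mem_filter, Finset.mem_range, Nat.ModEq, Nat.mod_eq_of_lt hc] at hb
    exact ⟨⟨b, hb.1⟩, by simpa using hb.2, rfl⟩

/-- If all fibres of `f` have size `c`, preimages have size proportional to the set. -/
theorem card_preimage_const {ι β : Type*} [Fintype ι] [Fintype β] [DecidableEq β]
    (f : ι → β) (c : ℕ) (hf : ∀ b, (Finset.univ.filter (fun i => f i = b)).card = c)
    (P : β → Prop) [DecidablePred P] :
    (Finset.univ.filter (fun i => P (f i))).card = (Finset.univ.filter P).card * c := by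
  rw [Finset.card_eq_sum_card_fiberwise (f := f) (t := Finset.univ.filter P)
    (by intro i hi; simpa using hi)]
  rw [Finset.sum_const_nat]
  intro b hb
  rw [← hf b, Finset.filter_filter]
  congr 1
  ext i
  simp only [Finset.mem_filter, Finset.mem_univ, true_and] at hb ⊢
  constructor
  · exact fun h => h.2
  · rintro rfl
    exact ⟨hb, rfl⟩

theorem card_pairs (m r : ℕ) (hr : 0 < r) (hdvd : r ∣ m) :
    (Finset.univ.filter (fun p : Fin m × Fin m => (p.1 : ℕ) % r = (p.2 : ℕ) % r)).card
      = m * (m / r) := by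
  rw [Finset.card_eq_sum_card_fiberwise (f := Prod.snd) (t := Finset.univ)
    (by intro i hi; simp)]
  rw [Finset.sum_const_nat (m := m / r)]
  · simp
  intro b _
  rw [← card_residue m r hr hdvd ((b : ℕ) % r) (Nat.mod_lt _ hr)]
  refine Finset.card_bij (fun p _ => p.1) ?_ ?_ ?_
  · intro p hp
    simp only [Finset.mem_filter, Finset.mem_univ, true_and] at hp ⊢
    rw [hp.1, hp.2]
  · intro p hp q hq h
    simp only [Finset.mem_filter, Finset.mem_univ, true_and] at hp hq
    exact Prod.ext h (hp.2.trans hq.2.symm)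
  · intro a ha
    exact ⟨(a, b), by simpa using ha, rfl⟩

/-- Reduction modulo `r`.  Let `n = m·λ` and let `A` be an `FPA_λ(n,d)` on symbols
`Fin m` such that between any two distinct rows every ordered pair of symbols occurs
in exactly `t` positions.  Let `r ≥ 2` divide `m`.  Then reducing all entries mod `r`
yields an `FPA_{n/r}(n, n − t·m²/r)`: each new row contains each residue exactly
`n/r` times, and rows coming from distinct rows of `A` have Hamming distance exactly
`n − t·m²/r`. -/
theorem stmt_16 (m lam t r d : ℕ) (hm : 0 < m) (hlam : 0 < lam)
    (hr : 2 ≤ r) (hdvd : r ∣ m)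
    (A : Finset (Fin (m * lam) → Fin m)) (hA : isFPA lam d A)
    (hpair : ∀ w ∈ A, ∀ v ∈ A, w ≠ v → ∀ a b : Fin m,
      (Finset.univ.filter (fun i => w i = a ∧ v i = b)).card = t) :
    (∀ w ∈ A, ∀ b : Fin r,
      (Finset.univ.filter
        (fun i => (⟨(w i : ℕ) % r, Nat.mod_lt _ (by omega)⟩ : Fin r) = b)).card
        = m * lam / r) ∧
    (∀ w ∈ A, ∀ v ∈ A, w ≠ v →
      hammingDist
          (fun i => (⟨(w i : ℕ) % r, Nat.mod_lt _ (by omega)⟩ : Fin r))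
          (fun i => (⟨(v i : ℕ) % r, Nat.mod_lt _ (by omega)⟩ : Fin r))
        = m * lam - t * (m * m) / r) := by
  have hr0 : 0 < r := by omega
  constructor
  · intro w hw b
    have h := card_preimage_const w lam (hA.1 w hw) (fun a => (a : ℕ) % r = (b : ℕ))
    rw [card_residue m r hr0 hdvd b b.2] at h
    simp only [Fin.ext_iff]
    rw [h]
    obtain ⟨k, rfl⟩ := hdvd
    rw [Nat.mul_div_cancel_left _ hr0, mul_assoc, Nat.mul_div_cancel_left _ hr0]
  · intro w hw v hv hne
    have h := card_preimage_const (fun i => (w i, v i)) t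
      (by
        rintro ⟨a, b⟩
        simpa only [Prod.mk.injEq] using hpair w hw v hv hne a b)
      (fun p => (p.1 : ℕ) % r = (p.2 : ℕ) % r)
    rw [card_pairs m r hr0 hdvd] at h
    have hs := Finset.card_filter_add_card_filter_not (s := (Finset.univ : Finset (Fin (m * lam))))
      (fun i => (w i : ℕ) % r = (v i : ℕ) % r)
    rw [Finset.card_univ, Fintype.card_fin] at hs
    have e : t * (m * m) / r = m * (m / r) * t := by
      obtain ⟨k, rfl⟩ := hdvd
      rw [Nat.mul_div_cancel_left _ hr0]
      apply Nat.div_eq_of_eq_mul_right hr0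
      ring
    unfold hammingDist
    simp only [ne_eq, Fin.ext_iff]
    rw [e]
    simp only at h
    omega
end

section
/- Let Γ₁,…,Γ_r be pairwise disjoint permutation arrays PA(n,δ), each of size N, whose union is a PA(n,d) (i.e. any two permutations lying in different Γ_i have Hamming distance at least d), and suppose 2d ≥ δ. Then the set Z = ⋃_{i=1}^r { uv : u, v ∈ Γ_i } of concatenations is a frequency permutation array FPA_2(2n, δ) of size rN²: each word of Z has length 2n and contains each of the n symbols exactly twice, and any two distinct words of Z have Hamming distance at least δ. -/
theorem append_inj_aux {n : ℕ} {a b c e : Fin n → Fin n}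
    (h : Fin.append a b = Fin.append c e) : a = c ∧ b = e := by
  constructor
  · funext k
    have := congrFun h (Fin.castAdd n k)
    simpa using this
  · funext k
    have := congrFun h (Fin.natAdd n k)
    simpa only [Fin.append_right] using this

theorem card_filter_append_aux {n : ℕ} (p : Fin (n + n) → Prop) [DecidablePred p] :
    (Finset.univ.filter p).card =
      (Finset.univ.filter (fun k : Fin n => p (Fin.castAdd n k))).card +
      (Finset.univ.filter (fun k : Fin n => p (Fin.natAdd n k))).card := by
  simp only [Finset.card_filter]
  rw [Fin.sum_univ_add]

theorem hammingDist_append_aux {n : ℕ} (a b c e : Fin n → Fin n) :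
    hammingDist (Fin.append a b) (Fin.append c e) = hammingDist a c + hammingDist b e := by
  unfold hammingDist
  rw [card_filter_append_aux]
  simp only [Fin.append_left, Fin.append_right]

/-- Separable PA product construction.  Let `Γ₁,…,Γ_r` be pairwise disjoint
`PA(n,δ)`'s, each of size `N`, such that permutations from different `Γ_i` have
Hamming distance at least `d`, and suppose `δ ≤ 2d`.  Then
`Z = ⋃ᵢ {uv : u,v ∈ Γᵢ}` is an `FPA_2(2n, δ)` of size `r·N²`. -/
theorem stmt_18 (n r N d δ : ℕ)
    (Γ : Fin r → Finset (Fin n → Fin n))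
    (hPA : ∀ i, isFPA 1 δ (Γ i))
    (hcard : ∀ i, (Γ i).card = N)
    (hdisj : ∀ i j, i ≠ j → Disjoint (Γ i) (Γ j))
    (hcross : ∀ i j, i ≠ j → ∀ u ∈ Γ i, ∀ v ∈ Γ j, d ≤ hammingDist u v)
    (hdd : δ ≤ 2 * d) :
    isFPA 2 δ
      (Finset.univ.biUnion
        (fun i => ((Γ i) ×ˢ (Γ i)).image (fun p => Fin.append p.1 p.2))) ∧
    (Finset.univ.biUnion
        (fun i => ((Γ i) ×ˢ (Γ i)).image (fun p => Fin.append p.1 p.2))).card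
      = r * N ^ 2 := by
  refine ⟨⟨?_, ?_⟩, ?_⟩
  · intro w hw s
    simp only [Finset.mem_biUnion, Finset.mem_image, Finset.mem_product, Finset.mem_univ,
      true_and, Prod.exists] at hw
    obtain ⟨i, a, b, ⟨ha, hb⟩, rfl⟩ := hw
    rw [card_filter_append_aux]
    simp only [Fin.append_left, Fin.append_right]
    rw [(hPA i).1 a ha s, (hPA i).1 b hb s]
  · intro w hw v hv hne
    simp only [Finset.mem_biUnion, Finset.mem_image, Finset.mem_product, Finset.mem_univ,
      true_and, Prod.exists] at hw hv
    obtain ⟨i, a, b, ⟨ha, hb⟩, rfl⟩ := hw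
    obtain ⟨j, c, e, ⟨hc, he⟩, rfl⟩ := hv
    rw [hammingDist_append_aux]
    by_cases hij : i = j
    · subst hij
      by_cases hac : a = c
      · have hbe : b ≠ e := by
          rintro rfl
          exact hne (by rw [hac])
        have := (hPA i).2 b hb e he hbe
        omega
      · have := (hPA i).2 a ha c hc hac
        omega
    · have h1 := hcross i j hij a ha c hc
      have h2 := hcross i j hij b hb e he
      omega
  · rw [Finset.card_biUnion]
    · have hi : ∀ i, (((Γ i) ×ˢ (Γ i)).image (fun p => Fin.append p.1 p.2)).card = N ^ 2 := by
        intro i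
        rw [Finset.card_image_of_injective, Finset.card_product, hcard, sq]
        rintro ⟨a, b⟩ ⟨c, e⟩ h
        obtain ⟨h1, h2⟩ := append_inj_aux h
        exact Prod.ext h1 h2
      simp [hi]
    · intro i _ j _ hij
      refine Finset.disjoint_left.mpr ?_
      intro w hw hv
      simp only [Finset.mem_image, Finset.mem_product, Prod.exists] at hw hv
      obtain ⟨a, b, ⟨ha, hb⟩, rfl⟩ := hw
      obtain ⟨c, e, ⟨hc, he⟩, h⟩ := hv
      obtain ⟨rfl, rfl⟩ := append_inj_aux h
      exact Finset.disjoint_left.mp (hdisj i j hij) ha hc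
end

section
/- Let n ≥ 2 be an even integer. Then M_{n/2}(n, n/2) = 2n − 2 if and only if there exists a Hadamard matrix of order n. Equivalently, the maximum number of binary words of length n, each of Hamming weight n/2, with pairwise Hamming distance at least n/2, equals 2n − 2 exactly when an n × n matrix H with entries ±1 satisfying H Hᵀ = n·I exists. -/
open Finset in
theorem key_lemma {E : Type*} [NormedAddCommGroup E] [InnerProductSpace ℝ E]
    [FiniteDimensional ℝ E] (m : ℕ) :
    ∀ (V : Submodule ℝ E) (S : Finset E), Module.finrank ℝ V = m →
      (∀ x ∈ S, x ∈ V) → (∀ x ∈ S, x ≠ 0) →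
      (∀ x ∈ S, ∀ y ∈ S, x ≠ y → inner ℝ x y ≤ 0) → 2 * m ≤ S.card →
      S.card = 2 * m ∧ ∃ B ⊆ S, B.card = m ∧ ∀ x ∈ B, ∀ y ∈ B, x ≠ y → inner ℝ x y = 0 := by
  classical
  induction m with
  | zero =>
    intro V S hV hSV h0 _ _
    have : V = ⊥ := Submodule.finrank_eq_zero.mp hV
    have hS : S = ∅ := by
      apply Finset.eq_empty_of_forall_notMem
      intro x hx
      have := hSV x hx
      subst V
      exact h0 x hx (by simpa using this)
    subst hS
    exact ⟨by simp, ∅, by simp⟩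
  | succ m ih =>
    intro V S hV hSV h0 hip hcard
    obtain ⟨u, hu⟩ : S.Nonempty := Finset.card_pos.mp (by omega)
    have hu0 := h0 u hu
    have huu : 0 < inner ℝ u u := real_inner_self_pos.mpr hu0
    set p : E → E := fun w => w - (inner ℝ w u / inner ℝ u u) • u with hp
    have hpu : ∀ w, inner ℝ (p w) u = 0 := by
      intro w
      simp only [hp, inner_sub_left, real_inner_smul_left]
      field_simp
      ring
    have hpp : ∀ w v, inner ℝ (p w) (p v) = inner ℝ w v - inner ℝ w u * inner ℝ v u / inner ℝ u u := by
      intro w v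
      have : inner ℝ (p w) (p v) = inner ℝ (p w) v := by
        conv_lhs => rw [show p v = v - (inner ℝ v u / inner ℝ u u) • u from rfl]
        rw [inner_sub_right, real_inner_smul_right, hpu]; ring
      rw [this]
      simp only [hp, inner_sub_left, real_inner_smul_left]
      rw [real_inner_comm v u]
      ring
    have hle : ∀ w ∈ S.erase u, ∀ v ∈ S.erase u, w ≠ v → inner ℝ (p w) (p v) ≤ 0 := by
      intro w hw v hv hwv
      rw [Finset.mem_erase] at hw hv
      rw [hpp]
      have h1 := hip w hw.2 v hv.2 hwv
      have h2 := hip w hw.2 u hu hw.1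
      have h3 := hip v hv.2 u hu hv.1
      have : 0 ≤ inner ℝ w u * inner ℝ v u / inner ℝ u u :=
        div_nonneg (mul_nonneg_of_nonpos_of_nonpos h2 h3) huu.le
      linarith
    have hz : ∀ w ∈ S.erase u, p w = 0 → w = (inner ℝ w u / inner ℝ u u) • u ∧ inner ℝ w u < 0 := by
      intro w hw hpw
      rw [Finset.mem_erase] at hw
      have h1 : w = (inner ℝ w u / inner ℝ u u) • u := sub_eq_zero.mp hpw
      refine ⟨h1, lt_of_le_of_ne (hip w hw.2 u hu hw.1) ?_⟩
      intro h
      rw [h] at h1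
      exact h0 w hw.2 (by simpa using h1)
    have hZ : ((S.erase u).filter (fun w => p w = 0)).card ≤ 1 := by
      rw [Finset.card_le_one]
      intro a ha b hb
      rw [Finset.mem_filter] at ha hb
      by_contra hab
      have h1 := hip a (Finset.mem_of_mem_erase ha.1) b (Finset.mem_of_mem_erase hb.1) hab
      have h2 := hpp a b
      rw [ha.2, inner_zero_left] at h2
      have : 0 < inner ℝ a u * inner ℝ b u / inner ℝ u u :=
        div_pos (mul_pos_of_neg_of_neg (hz a ha.1 ha.2).2 (hz b hb.1 hb.2).2) huu
      linarith
    set R := (S.erase u).filter (fun w => ¬ p w = 0) with hR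
    have hsum : ((S.erase u).filter (fun w => p w = 0)).card + R.card = (S.erase u).card :=
      Finset.card_filter_add_card_filter_not _
    have hSe : (S.erase u).card = S.card - 1 := Finset.card_erase_of_mem hu
    have hinj : Set.InjOn p (R : Set E) := by
      intro a ha b hb hab
      by_contra hne
      have ha' := Finset.mem_filter.mp (Finset.mem_coe.mp ha)
      have hb' := Finset.mem_filter.mp (Finset.mem_coe.mp hb)
      have h1 := hle a ha'.1 b hb'.1 hne
      rw [← hab] at h1
      have := real_inner_self_pos.mpr ha'.2
      linarith
    have hRc : (R.image p).card = R.card := Finset.card_image_of_injOn hinj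
    have hspan : ℝ ∙ u ≤ V := by
      rw [Submodule.span_singleton_le_iff_mem]; exact hSV u hu
    have hdim : Module.finrank ℝ ((ℝ ∙ u)ᗮ ⊓ V : Submodule ℝ E) = m := by
      have := Submodule.finrank_add_inf_finrank_orthogonal hspan
      rw [finrank_span_singleton hu0, hV] at this
      omega
    obtain ⟨hc, B, hBS, hBc, hB⟩ := ih ((ℝ ∙ u)ᗮ ⊓ V) (R.image p) hdim
      (by
        intro x hx
        obtain ⟨w, hw, rfl⟩ := Finset.mem_image.mp hx
        refine ⟨?_, ?_⟩
        · exact Submodule.mem_orthogonal_singleton_iff_inner_left.mpr (hpu w)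
        · exact V.sub_mem (hSV w (Finset.mem_of_mem_erase (Finset.mem_filter.mp hw).1))
            (V.smul_mem _ (hSV u hu)))
      (by
        intro x hx
        obtain ⟨w, hw, rfl⟩ := Finset.mem_image.mp hx
        exact (Finset.mem_filter.mp hw).2)
      (by
        intro x hx y hy hxy
        obtain ⟨w, hw, rfl⟩ := Finset.mem_image.mp hx
        obtain ⟨v, hv, rfl⟩ := Finset.mem_image.mp hy
        exact hle w (Finset.mem_filter.mp hw).1 v (Finset.mem_filter.mp hv).1
          (fun h => hxy (by rw [h])))
      (by omega)
    have hZ1 : 0 < ((S.erase u).filter (fun w => p w = 0)).card := by omega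
    obtain ⟨z, hzm⟩ := Finset.card_pos.mp hZ1
    rw [Finset.mem_filter] at hzm
    obtain ⟨hz1, hz2⟩ := hz z hzm.1 hzm.2
    have horth : ∀ w ∈ R, inner ℝ w u = 0 := by
      intro w hw
      have hw' := Finset.mem_filter.mp hw
      have hwS := Finset.mem_erase.mp hw'.1
      have h1 := hip w hwS.2 u hu hwS.1
      have hwz : w ≠ z := by
        rintro rfl
        exact hw'.2 hzm.2
      have h2 := hip w hwS.2 z (Finset.mem_of_mem_erase hzm.1) hwz
      rw [hz1, real_inner_smul_right] at h2
      have h3 : inner ℝ z u / inner ℝ u u < 0 := div_neg_of_neg_of_pos hz2 huu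
      nlinarith
    have hpR : ∀ w ∈ R, p w = w := by
      intro w hw
      simp [hp, horth w hw]
    have hBR : B ⊆ R := by
      intro x hx
      obtain ⟨w, hw, rfl⟩ := Finset.mem_image.mp (hBS hx)
      rw [hpR w hw]; exact hw
    have huB : u ∉ B := fun h => by
      have := horth u (hBR h)
      linarith
    refine ⟨by omega, insert u B, ?_, ?_, ?_⟩
    · intro x hx
      rcases Finset.mem_insert.mp hx with rfl | hx
      · exact hu
      · exact Finset.mem_of_mem_erase (Finset.mem_filter.mp (hBR hx)).1
    · rw [Finset.card_insert_of_notMem huB, hBc]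
    · intro x hx y hy hxy
      rcases Finset.mem_insert.mp hx with hxu | hx <;> rcases Finset.mem_insert.mp hy with hyu | hy
      · exact absurd (hxu.trans hyu.symm) hxy
      · rw [hxu, real_inner_comm]; exact horth y (hBR hy)
      · rw [hyu]; exact horth x (hBR hx)
      · exact hB x hx y hy hxy

/-- sign of a symbol -/
def sg (s : Fin 2) : ℝ := if s = 0 then 1 else -1

theorem sg_cases (s : Fin 2) : sg s = 1 ∨ sg s = -1 := by
  unfold sg; split_ifs <;> simp

theorem sg_inj {s t : Fin 2} (h : sg s = sg t) : s = t := by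
  unfold sg at h
  fin_cases s <;> fin_cases t <;> first | rfl | (norm_num at h)

theorem sg_sum {n : ℕ} (w v : Fin n → Fin 2) :
    ∑ j, sg (w j) * sg (v j) = (n : ℝ) - 2 * (hammingDist w v : ℝ) := by
  have h1 : ∀ j, sg (w j) * sg (v j) = 1 - 2 * (if w j ≠ v j then (1 : ℝ) else 0) := by
    intro j
    generalize w j = a
    generalize v j = b
    unfold sg
    fin_cases a <;> fin_cases b <;> norm_num
  rw [Finset.sum_congr rfl (fun j _ => h1 j), Finset.sum_sub_distrib, ← Finset.mul_sum,
    Finset.sum_boole]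
  simp [hammingDist]

theorem sg_sum_one {n : ℕ} (w : Fin n → Fin 2) (s : Fin 2) :
    2 * ((Finset.univ.filter (fun i => w i = s)).card : ℝ) = n + sg s * ∑ j, sg (w j) := by
  have h1 : ∀ j, sg s * sg (w j) = 2 * (if w j = s then (1 : ℝ) else 0) - 1 := by
    intro j
    generalize w j = a
    unfold sg
    fin_cases a <;> fin_cases s <;> norm_num
  rw [Finset.mul_sum, Finset.sum_congr rfl (fun j _ => h1 j), Finset.sum_sub_distrib,
    ← Finset.mul_sum, Finset.sum_boole]
  simp

/-- vector of a word -/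
noncomputable def vec {n : ℕ} (w : Fin n → Fin 2) : EuclideanSpace ℝ (Fin n) :=
  WithLp.toLp 2 (fun j => sg (w j))

theorem vec_inner {n : ℕ} (w v : Fin n → Fin 2) :
    inner ℝ (vec w) (vec v) = ∑ j, sg (w j) * sg (v j) := by
  simp [vec, PiLp.inner_apply, mul_comm]

theorem vec_inj {n : ℕ} : Function.Injective (vec (n := n)) := by
  intro w v h
  funext j
  have := congrArg (fun x : EuclideanSpace ℝ (Fin n) => x j) h
  exact sg_inj this

theorem upper (n : ℕ) (hn : 2 ≤ n) (he : 2 ∣ n) (T : Finset (Fin n → Fin 2))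
    (hT : isFPA (n / 2) (n / 2) T) (hc : 2 * n ≤ T.card + 2) :
    T.card + 2 = 2 * n ∧ ∃ H : Matrix (Fin n) (Fin n) ℝ,
      (∀ i j, H i j = 1 ∨ H i j = -1) ∧
      H * H.transpose = (n : ℝ) • (1 : Matrix (Fin n) (Fin n) ℝ) := by
  classical
  obtain ⟨k, rfl⟩ := he
  have hk : 2 * k / 2 = k := by omega
  rw [hk] at hT
  obtain ⟨hT1, hT2⟩ := hT
  have hnpos : (0 : ℝ) < (2 * k : ℕ) := by exact_mod_cast (by omega : 0 < 2 * k)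
  have hsum0 : ∀ w ∈ T, ∑ j, sg (w j) = 0 := by
    intro w hw
    have := sg_sum_one w 0
    rw [hT1 w hw 0] at this
    simp [sg] at this ⊢
    linarith
  have hconst : ∀ w ∈ T, ∀ s : Fin 2,
      inner ℝ (vec w) (vec (fun _ : Fin (2 * k) => s)) = 0 := by
    intro w hw s
    rw [vec_inner, ← Finset.sum_mul, hsum0 w hw, zero_mul]
  have hself : ∀ w : Fin (2 * k) → Fin 2, inner ℝ (vec w) (vec w) = ((2 * k : ℕ) : ℝ) := by
    intro w
    rw [vec_inner, sg_sum]; simp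
  have hcc : ∀ s t : Fin 2, s ≠ t →
      inner ℝ (vec (fun _ : Fin (2 * k) => s)) (vec (fun _ : Fin (2 * k) => t)) ≤ 0 := by
    intro s t hst
    rw [vec_inner]
    have : sg s * sg t = -1 := by
      unfold sg
      fin_cases s <;> fin_cases t <;> simp at hst ⊢
    simp only [this]
    simp
  set C : Finset (Fin (2 * k) → Fin 2) := Finset.univ.image (fun s : Fin 2 => fun _ => s) with hC
  have hCc : C.card = 2 := by
    rw [hC, Finset.card_image_of_injective]
    · simp
    · intro s t h
      exact congrFun h ⟨0, by omega⟩
  have hdisj : Disjoint T C := by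
    rw [Finset.disjoint_left]
    intro w hw hwC
    obtain ⟨s, -, rfl⟩ := Finset.mem_image.mp hwC
    have h1 := hconst _ hw s
    rw [hself] at h1
    linarith
  have hUc : (T ∪ C).card = T.card + 2 := by
    rw [Finset.card_union_of_disjoint hdisj, hCc]
  have hSc : ((T ∪ C).image vec).card = T.card + 2 := by
    rw [Finset.card_image_of_injective _ vec_inj, hUc]
  obtain ⟨h1, B, hBS, hBc, hB⟩ := key_lemma (2 * k) (⊤ : Submodule ℝ (EuclideanSpace ℝ (Fin (2 * k))))
    ((T ∪ C).image vec) (by simp) (by simp)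
    (by
      intro x hx
      obtain ⟨w, -, rfl⟩ := Finset.mem_image.mp hx
      intro h
      have := hself w
      rw [h, inner_zero_left] at this
      linarith)
    (by
      intro x hx y hy hxy
      obtain ⟨w, hw, rfl⟩ := Finset.mem_image.mp hx
      obtain ⟨v, hv, rfl⟩ := Finset.mem_image.mp hy
      have hwv : w ≠ v := fun h => hxy (by rw [h])
      rcases Finset.mem_union.mp hw with hw | hw <;> rcases Finset.mem_union.mp hv with hv | hv
      · have := hT2 w hw v hv hwv
        rw [vec_inner, sg_sum]
        have : (k : ℝ) ≤ hammingDist w v := by exact_mod_cast this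
        push_cast
        linarith
      · obtain ⟨s, -, rfl⟩ := Finset.mem_image.mp hv
        exact (hconst w hw s).le
      · obtain ⟨s, -, rfl⟩ := Finset.mem_image.mp hw
        rw [real_inner_comm]
        exact (hconst v hv s).le
      · obtain ⟨s, -, rfl⟩ := Finset.mem_image.mp hw
        obtain ⟨t, -, rfl⟩ := Finset.mem_image.mp hv
        exact hcc s t (fun h => hwv (by rw [h])))
    (by rw [hSc]; exact hc)
  refine ⟨by rw [← hSc, h1], ?_⟩
  let e := (B.equivFinOfCardEq hBc).symm
  have hrow : ∀ i, ∃ w : Fin (2 * k) → Fin 2, vec w = (e i : EuclideanSpace ℝ (Fin (2 * k))) := by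
    intro i
    obtain ⟨w, -, h⟩ := Finset.mem_image.mp (hBS (e i).2)
    exact ⟨w, h⟩
  choose r hr using hrow
  refine ⟨Matrix.of (fun i j => sg (r i j)), fun i j => sg_cases _, ?_⟩
  ext i j
  rw [Matrix.mul_apply]
  simp only [Matrix.transpose_apply, Matrix.of_apply, Matrix.smul_apply]
  rw [← vec_inner]
  by_cases hij : i = j
  · subst hij
    rw [hself]; simp
  · rw [hr, hr, hB _ (e i).2 _ (e j).2 (fun h => hij (e.injective (Subtype.ext h)))]
    simp [hij]

theorem lower (n : ℕ) (hn : 2 ≤ n) (he : 2 ∣ n) (H : Matrix (Fin n) (Fin n) ℝ)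
    (h1 : ∀ i j, H i j = 1 ∨ H i j = -1)
    (h2 : H * H.transpose = (n : ℝ) • (1 : Matrix (Fin n) (Fin n) ℝ)) :
    ∃ T : Finset (Fin n → Fin 2), isFPA (n / 2) (n / 2) T ∧ T.card = 2 * n - 2 := by
  classical
  have hnpos : (0 : ℝ) < n := by exact_mod_cast (by omega : 0 < n)
  have horth : ∀ i k, i ≠ k → ∑ j, H i j * H k j = 0 := by
    intro i k hik
    have := congrFun (congrFun h2 i) k
    rw [Matrix.mul_apply] at this
    simpa [hik] using this
  let o : Fin n := ⟨0, by omega⟩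
  let f : Fin n × Fin 2 → Fin n → Fin 2 := fun q j => if H q.1 j = H o j then q.2 else 1 - q.2
  have hf : ∀ q j, sg (f q j) = sg q.2 * (H q.1 j * H o j) := by
    rintro ⟨i, s⟩ j
    simp only [f]
    have : sg (1 - s) = - sg s := by
      unfold sg
      fin_cases s <;> simp
    rcases h1 i j with h | h <;> rcases h1 o j with h' | h' <;> rw [h, h'] <;> norm_num [this]
  have hip : ∀ q q' : Fin n × Fin 2, q ≠ q' → ∑ j, sg (f q j) * sg (f q' j) ≤ 0 := by
    rintro ⟨i, s⟩ ⟨k, t⟩ hne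
    have : ∀ j, sg (f (i, s) j) * sg (f (k, t) j) = sg s * sg t * (H i j * H k j) := by
      intro j
      rw [hf, hf]
      have : H o j * H o j = 1 := by rcases h1 o j with h | h <;> rw [h] <;> norm_num
      linear_combination (sg s * sg t * H i j * H k j) * this
    rw [Finset.sum_congr rfl (fun j _ => this j), ← Finset.mul_sum]
    by_cases hik : i = k
    · subst hik
      have hst : s ≠ t := fun h => hne (by rw [h])
      have hs : sg s * sg t = -1 := by
        unfold sg
        fin_cases s <;> fin_cases t <;> simp at hst ⊢
      rw [hs]
      have : 0 ≤ ∑ j, H i j * H i j := Finset.sum_nonneg (fun j _ => mul_self_nonneg _)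
      linarith
    · rw [horth i k hik, mul_zero]
  have hinj : Function.Injective f := by
    intro q q' h
    by_contra hne
    have := hip q q' hne
    rw [h, sg_sum] at this
    simp at this
    omega
  refine ⟨((Finset.univ.erase o) ×ˢ Finset.univ).image f, ⟨?_, ?_⟩, ?_⟩
  · intro w hw s
    obtain ⟨q, hq, rfl⟩ := Finset.mem_image.mp hw
    have hqo : q.1 ≠ o := by
      have := (Finset.mem_product.mp hq).1
      exact (Finset.mem_erase.mp this).1
    have h := sg_sum_one (f q) s
    have hz : ∑ j, sg (f q j) = 0 := by
      rw [Finset.sum_congr rfl (fun j _ => hf q j), ← Finset.mul_sum, horth _ _ hqo, mul_zero]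
    rw [hz, mul_zero, add_zero] at h
    have h' : 2 * (Finset.univ.filter (fun i => f q i = s)).card = n := by exact_mod_cast h
    omega
  · intro w hw v hv hwv
    obtain ⟨q, hq, rfl⟩ := Finset.mem_image.mp hw
    obtain ⟨q', hq', rfl⟩ := Finset.mem_image.mp hv
    have h := hip q q' (fun h => hwv (by rw [h]))
    rw [sg_sum] at h
    have h' : n ≤ 2 * hammingDist (f q) (f q') := by
      have : (n : ℝ) ≤ 2 * (hammingDist (f q) (f q') : ℝ) := by linarith
      exact_mod_cast this
    omega
  · rw [Finset.card_image_of_injective _ hinj, Finset.card_product,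
      Finset.card_erase_of_mem (Finset.mem_univ _)]
    simp
    omega

/-- For even `n ≥ 2`, `M_{n/2}(n, n/2) = 2n − 2` if and only if there exists a
Hadamard matrix of order `n` (an `n × n` matrix with entries `±1` and `H·Hᵀ = n·I`). -/
theorem stmt_19 (n : ℕ) (hn : 2 ≤ n) (he : 2 ∣ n) :
    M n 2 (n / 2) (n / 2) = 2 * n - 2 ↔
    ∃ H : Matrix (Fin n) (Fin n) ℝ,
      (∀ i j, H i j = 1 ∨ H i j = -1) ∧
      H * H.transpose = (n : ℝ) • (1 : Matrix (Fin n) (Fin n) ℝ) := by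
  have hub : ∀ N ∈ {N | ∃ T : Finset (Fin n → Fin 2), isFPA (n / 2) (n / 2) T ∧ T.card = N},
      N ≤ 2 * n - 2 := by
    rintro N ⟨T, hT, rfl⟩
    by_contra hlt
    have := (upper n hn he T hT (by omega)).1
    omega
  have hbdd : BddAbove {N | ∃ T : Finset (Fin n → Fin 2), isFPA (n / 2) (n / 2) T ∧ T.card = N} :=
    ⟨_, hub⟩
  have hne : {N | ∃ T : Finset (Fin n → Fin 2),
      isFPA (n / 2) (n / 2) T ∧ T.card = N}.Nonempty :=
    ⟨0, ∅, by simp [isFPA], by simp⟩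
  constructor
  · intro h
    obtain ⟨T, hT, hc⟩ := Nat.sSup_mem hne hbdd
    have hc' : T.card = 2 * n - 2 := hc.trans h
    exact (upper n hn he T hT (by omega)).2
  · rintro ⟨H, h1, h2⟩
    exact le_antisymm (csSup_le hne hub) (le_csSup hbdd (lower n hn he H h1 h2))
end
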